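/- arXiv:1802.06291 — 3 statements merged into one kernel-verified Lean document; each statement's English description precedes it below -/
import Mathlib

section
/- Let H be a bivariate max-stable df with unit Fréchet marginals. Then the extremal coefficient θ(H) = −ln H(1,1) equals 2 if and only if H(x₁,x₂) = Φ(x₁)Φ(x₂) for all (x₁,x₂) ∈ ℝ². -/
open MeasureTheory Filter Topology ProbabilityTheory
open scoped ENNReal

/-- The unit Fréchet distribution function `Φ(x) = exp(-1/x)` for `x > 0`, `0` otherwise. -/
noncomputable def frechet (x : ℝ) : ℝ := if 0 < x then Real.exp (-(1/x)) else 0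

/-- The distribution function of a Borel measure on `ℝ^d`. -/
noncomputable def df {d : ℕ} (ρ : Measure (Fin d → ℝ)) (x : Fin d → ℝ) : ℝ :=
  (ρ {y | ∀ i, y i ≤ x i}).toReal

/-- The `i`-th marginal distribution function of a Borel measure on `ℝ^d`. -/
noncomputable def marg {d : ℕ} (ρ : Measure (Fin d → ℝ)) (i : Fin d) (t : ℝ) : ℝ :=
  (ρ {y | y i ≤ t}).toReal

/-- All one-dimensional marginal dfs equal the unit Fréchet df. -/
def HasFrechetMarginals {d : ℕ} (ρ : Measure (Fin d → ℝ)) : Prop :=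
  ∀ (i : Fin d) (t : ℝ), marg ρ i t = frechet t

/-- The measure is concentrated on `[0,∞)^d`. -/
def SupportedOnNonneg {d : ℕ} (ρ : Measure (Fin d → ℝ)) : Prop :=
  ρ {y | ∃ i, y i < 0} = 0

/-- Max-infinite divisibility: for every `t > 0`, `H^t` is again a df of a Borel
probability measure. -/
def MaxID {d : ℕ} (ρ : Measure (Fin d → ℝ)) : Prop :=
  ∀ t : ℝ, 0 < t → ∃ ν : Measure (Fin d → ℝ), IsProbabilityMeasure ν ∧
    ∀ x, df ν x = (df ρ x) ^ t

/-- Max-stability (for a df with unit Fréchet marginals):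
`H(t x₁, …, t x_d) = H(x₁, …, x_d)^(1/t)` for all `t > 0` and `x ∈ (0,∞)^d`. -/
def MaxStable {d : ℕ} (ρ : Measure (Fin d → ℝ)) : Prop :=
  ∀ t : ℝ, 0 < t → ∀ x : Fin d → ℝ, (∀ i, 0 < x i) →
    df ρ (fun i => t * x i) = (df ρ x) ^ (1/t)

/-- `υ` is an exponent measure of the max-id df of `ρ`:
`υ{y : y_i > x_i for some i} = -ln H(x)` for all `x ∈ (0,∞)^d`. -/
def IsExponentMeasure {d : ℕ} (ρ υ : Measure (Fin d → ℝ)) : Prop :=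
  ∀ x : Fin d → ℝ, (∀ i, 0 < x i) →
    (υ {y | ∃ i, x i < y i}).toReal = - Real.log (df ρ x)

/-- The positive orthant `(0,∞)^d`. -/
def posOrthant (d : ℕ) : Set (Fin d → ℝ) := {x | ∀ i, 0 < x i}

/-- `F` is in the max-domain of attraction of `H` with norming constants `a_n = n`:
`F(n x)^n → H(x)` for every `x ∈ (0,∞)^d`. -/
def MDA {d : ℕ} (ρ ρH : Measure (Fin d → ℝ)) : Prop :=
  ∀ x : Fin d → ℝ, (∀ i, 0 < x i) →
    Tendsto (fun n : ℕ => (df ρ (fun i => (n : ℝ) * x i)) ^ n) atTop (𝓝 (df ρH x))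

/-- Inclusion–exclusion: the probability that some coordinate lies below its threshold. -/
theorem measureReal_union_eq_marg_add_marg_sub_df (ρ : Measure (Fin 2 → ℝ))
    [IsProbabilityMeasure ρ] (x : Fin 2 → ℝ) :
    ρ.real ({y | y 0 ≤ x 0} ∪ {y | y 1 ≤ x 1}) =
      marg ρ 0 (x 0) + marg ρ 1 (x 1) - df ρ x := by
  have hB : MeasurableSet {y : Fin 2 → ℝ | y 1 ≤ x 1} :=
    measurableSet_le (measurable_pi_apply 1) measurable_const
  have h := measureReal_union_add_inter (μ := ρ) (s := {y | y 0 ≤ x 0}) hB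
  have hI : {y : Fin 2 → ℝ | y 0 ≤ x 0} ∩ {y | y 1 ≤ x 1} = {y | ∀ i, y i ≤ x i} := by
    ext y
    simp [Fin.forall_fin_two]
  rw [hI] at h
  simp only [Measure.real] at h
  simp only [marg, df, Measure.real]
  linarith

theorem df_mono {d : ℕ} (ρ : Measure (Fin d → ℝ)) [IsProbabilityMeasure ρ] {x z : Fin d → ℝ}
    (h : ∀ i, x i ≤ z i) : df ρ x ≤ df ρ z :=
  measureReal_mono (μ := ρ) fun _ hy i => (hy i).trans (h i)

theorem df_le_marg {d : ℕ} (ρ : Measure (Fin d → ℝ)) [IsProbabilityMeasure ρ] (x : Fin d → ℝ)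
    (i : Fin d) : df ρ x ≤ marg ρ i (x i) :=
  measureReal_mono (μ := ρ) fun _ hy => hy i

theorem df_eq_zero_of_nonpos {d : ℕ} {ρ : Measure (Fin d → ℝ)} [IsProbabilityMeasure ρ]
    (hm : HasFrechetMarginals ρ) {x : Fin d → ℝ} {i : Fin d} (hi : x i ≤ 0) : df ρ x = 0 := by
  refine le_antisymm ?_ ENNReal.toReal_nonneg
  have h := df_le_marg ρ x i
  rwa [hm, frechet, if_neg hi.not_gt] at h

/-- If the joint upper tail on the scale `1 / s` is `O(s ^ 2)` as `s → 0+`, then the exponent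
is additive. -/
theorem eq_add_of_exp_tail_le_sq {a b v c : ℝ}
    (h0 : ∀ s : ℝ, 0 < s →
      0 ≤ 1 - (Real.exp (-(s * a)) + Real.exp (-(s * b)) - Real.exp (-(s * v))))
    (h1 : ∀ s : ℝ, 0 < s →
      1 - (Real.exp (-(s * a)) + Real.exp (-(s * b)) - Real.exp (-(s * v))) ≤ c * s ^ 2) :
    v = a + b := by
  have he (k : ℝ) : HasDerivAt (fun s : ℝ => Real.exp (-(s * k))) (-k) 0 := by
    simpa using (((hasDerivAt_id (0 : ℝ)).mul_const k).neg).exp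
  have hd := ((((he a).add (he b)).sub (he v)).const_sub 1).tendsto_slope_zero_right
  have hz : Tendsto (fun s : ℝ => c * s) (𝓝[>] 0) (𝓝 0) := by
    have : Tendsto (fun s : ℝ => c * s) (𝓝 0) (𝓝 (c * 0)) := tendsto_id.const_mul c
    rw [mul_zero] at this
    exact this.mono_left nhdsWithin_le_nhds
  have hd0 := tendsto_of_tendsto_of_tendsto_of_le_of_le' tendsto_const_nhds hz
    (f := fun t : ℝ => t⁻¹ *
      (1 - (Real.exp (-(t * a)) + Real.exp (-(t * b)) - Real.exp (-(t * v)))))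
    (by
      filter_upwards [self_mem_nhdsWithin] with s hs
      exact mul_nonneg (inv_nonneg.2 (le_of_lt hs)) (h0 s hs))
    (by
      filter_upwards [self_mem_nhdsWithin] with s hs
      have hs' : (0 : ℝ) < s := hs
      rw [inv_mul_le_iff₀ hs']
      linarith [h1 s hs'])
  have := tendsto_nhds_unique (hd.congr fun t => by simp) hd0
  linarith

/-- A max-stable df is exponential along rays. -/
theorem MaxStable.df_div {d : ℕ} {ρ : Measure (Fin d → ℝ)} (h : MaxStable ρ) {x : Fin d → ℝ}
    (hx : ∀ i, 0 < x i) (hpos : 0 < df ρ x) {s : ℝ} (hs : 0 < s) :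
    df ρ (fun i => x i / s) = Real.exp (-(s * -Real.log (df ρ x))) := by
  have := h s⁻¹ (inv_pos.2 hs) x hx
  simp only [one_div, inv_inv] at this
  simp only [div_eq_inv_mul, this, Real.rpow_def_of_pos hpos]
  ring_nf

theorem frechet_div {x s : ℝ} (hx : 0 < x) (hs : 0 < s) :
    frechet (x / s) = Real.exp (-(s * x⁻¹)) := by
  rw [frechet, if_pos (div_pos hx hs), one_div_div, div_eq_mul_inv]

theorem neg_log_df_eq_of_extremal_coefficient_eq_two {ρ : Measure (Fin 2 → ℝ)}
    [IsProbabilityMeasure ρ] (hm : HasFrechetMarginals ρ) (hms : MaxStable ρ)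
    (h2 : -Real.log (df ρ (fun _ => 1)) = 2) {x : Fin 2 → ℝ} (hx : ∀ i, 0 < x i) :
    0 < df ρ x ∧ -Real.log (df ρ x) = (x 0)⁻¹ + (x 1)⁻¹ := by
  set m := min (x 0) (x 1)
  have hm0 : 0 < m := lt_min (hx 0) (hx 1)
  have hmx : ∀ i, m ≤ x i := Fin.forall_fin_two.2 ⟨min_le_left _ _, min_le_right _ _⟩
  have h1pos : 0 < df ρ (fun _ => 1) := by
    refine lt_of_le_of_ne ENNReal.toReal_nonneg fun h => ?_
    rw [← h] at h2
    norm_num at h2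
  have hdiag (r : ℝ) (hr : 0 < r) : df ρ (fun _ => r) = Real.exp (-(r⁻¹ * 2)) := by
    have := hms.df_div (fun _ => one_pos) h1pos (inv_pos.2 hr)
    simpa [h2] using this
  have hpos : 0 < df ρ x := by
    refine lt_of_lt_of_le ?_ (df_mono ρ hmx)
    rw [hdiag m hm0]
    exact Real.exp_pos _
  refine ⟨hpos, eq_add_of_exp_tail_le_sq (c := m⁻¹ ^ 2) ?_ ?_⟩
  all_goals
    intro s hs
    have hU := measureReal_union_eq_marg_add_marg_sub_df ρ (fun i => x i / s)
    rw [hm, hm, frechet_div (hx 0) hs, frechet_div (hx 1) hs, hms.df_div hx hpos hs] at hU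
    rw [← hU]
  · linarith [measureReal_le_one (μ := ρ)
      (s := {y | y 0 ≤ x 0 / s} ∪ {y : Fin 2 → ℝ | y 1 ≤ x 1 / s})]
  · have hV := measureReal_union_eq_marg_add_marg_sub_df ρ (fun _ => m / s)
    rw [hm, hm, frechet_div hm0 hs, hdiag _ (div_pos hm0 hs)] at hV
    have hmono : ρ.real ({y | y 0 ≤ m / s} ∪ {y | y 1 ≤ m / s}) ≤
        ρ.real ({y | y 0 ≤ x 0 / s} ∪ {y | y 1 ≤ x 1 / s}) := by
      refine measureReal_mono (Set.union_subset_union ?_ ?_)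
      · exact fun y hy => le_trans hy (div_le_div_of_nonneg_right (hmx 0) hs.le)
      · exact fun y hy => le_trans hy (div_le_div_of_nonneg_right (hmx 1) hs.le)
    have hsq : Real.exp (-((m / s)⁻¹ * 2)) = Real.exp (-(s * m⁻¹)) ^ 2 := by
      rw [← Real.exp_nat_mul, inv_div, div_eq_mul_inv]
      push_cast
      ring_nf
    rw [hsq] at hV
    have hk : 0 < s * m⁻¹ := mul_pos hs (inv_pos.2 hm0)
    have hle := Real.add_one_le_exp (-(s * m⁻¹))
    have hle1 : Real.exp (-(s * m⁻¹)) ≤ 1 := Real.exp_le_one_iff.2 (by linarith)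
    have : (1 - Real.exp (-(s * m⁻¹))) ^ 2 ≤ (s * m⁻¹) ^ 2 :=
      pow_le_pow_left₀ (by linarith) (by linarith) 2
    nlinarith

/-- For a bivariate max-stable df `H` with unit Fréchet marginals,
the extremal coefficient `θ(H) = -ln H(1,1)` equals `2` iff
`H(x₁,x₂) = Φ(x₁)Φ(x₂)` for all `(x₁,x₂) ∈ ℝ²`. -/
theorem stmt14 (ρH : Measure (Fin 2 → ℝ)) [IsProbabilityMeasure ρH]
    (hHm : HasFrechetMarginals ρH) (hHms : MaxStable ρH) :
    -Real.log (df ρH (fun _ => 1)) = 2 ↔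
      ∀ x : Fin 2 → ℝ, df ρH x = frechet (x 0) * frechet (x 1) := by
  constructor
  · intro h2 x
    by_cases hx : ∀ i, 0 < x i
    · obtain ⟨hpos, hlog⟩ := neg_log_df_eq_of_extremal_coefficient_eq_two hHm hHms h2 hx
      rw [← Real.exp_log hpos, frechet, frechet, if_pos (hx 0), if_pos (hx 1), ← Real.exp_add]
      congr 1
      simp only [one_div]
      linarith
    · push Not at hx
      obtain ⟨i, hi⟩ := hx
      have hf : frechet (x i) = 0 := if_neg hi.not_gt
      rw [df_eq_zero_of_nonpos hHm hi]
      revert hf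
      fin_cases i <;> simp +contextual
  · intro h
    rw [h, frechet, if_pos one_pos, ← Real.exp_add, Real.log_exp]
    norm_num
end

section
/- Let H be a bivariate max-stable df with unit Fréchet marginals and let υ be an exponent measure of H. Then for every u > 0 and t > 0: ∫_{(0,∞)²} min( exp(−1/(u x₁)), exp(−1/(t x₂)) ) dυ(x₁,x₂) = u + t + ln H(1/u, 1/t). -/
open MeasureTheory Filter Topology ProbabilityTheory
open scoped ENNReal

/-- Outside the coordinate `i`, every point is eventually below the vectors whose coordinates
other than `i` tend to infinity. -/
theorem eventually_le_update {d : ℕ} (i : Fin d) (a : ℝ) (y : Fin d → ℝ) :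
    ∀ᶠ n : ℕ in atTop, ∀ j, j ≠ i → y j ≤ Function.update (fun _ => (n : ℝ) + 1) i a j := by
  rw [Filter.eventually_all]
  intro j
  filter_upwards [tendsto_natCast_atTop_atTop.eventually_ge_atTop (y j)] with n hn hj
  rw [Function.update_of_ne hj]
  linarith

/-- A max-stable df is positive on the open positive orthant. -/
theorem MaxStable.df_pos {d : ℕ} {ρ : Measure (Fin d → ℝ)} [IsProbabilityMeasure ρ]
    (h : MaxStable ρ) {x : Fin d → ℝ} (hx : ∀ i, 0 < x i) : 0 < df ρ x := by
  refine lt_of_le_of_ne ENNReal.toReal_nonneg fun h0 => ?_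
  have hz : ∀ n : ℕ, ρ {y | ∀ i, y i ≤ ((n : ℝ) + 1) * x i} = 0 := fun n => by
    have h1 := h ((n : ℝ) + 1) (by positivity) x hx
    rw [← h0, Real.zero_rpow (by positivity)] at h1
    exact (ENNReal.toReal_eq_zero_iff _).1 h1 |>.resolve_right (measure_ne_top _ _)
  have hU : (⋃ n : ℕ, {y : Fin d → ℝ | ∀ i, y i ≤ ((n : ℝ) + 1) * x i}) = Set.univ := by
    refine Set.eq_univ_of_forall fun y => ?_
    have : ∀ᶠ n : ℕ in atTop, ∀ i, y i ≤ ((n : ℝ) + 1) * x i := by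
      rw [Filter.eventually_all]
      intro i
      filter_upwards [tendsto_natCast_atTop_atTop.eventually_ge_atTop (y i / x i)] with n hn
      rw [div_le_iff₀ (hx i)] at hn
      nlinarith [hx i]
    obtain ⟨n, hn⟩ := this.exists
    exact Set.mem_iUnion.2 ⟨n, hn⟩
  have h1 : ρ Set.univ = 0 := by
    rw [← hU]
    exact measure_iUnion_null hz
  simp at h1

theorem HasFrechetMarginals.df_lt_one {d : ℕ} {ρ : Measure (Fin d → ℝ)} [IsProbabilityMeasure ρ]
    (h : HasFrechetMarginals ρ) (i : Fin d) {x : Fin d → ℝ} (hx : 0 < x i) : df ρ x < 1 := by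
  have h1 : df ρ x ≤ marg ρ i (x i) :=
    ENNReal.toReal_mono (measure_ne_top _ _) (measure_mono fun y hy => hy i)
  rw [h i, frechet, if_pos hx] at h1
  refine h1.trans_lt (Real.exp_lt_one_iff.2 ?_)
  have : 0 < 1 / x i := by positivity
  linarith

/-- The df converges to its marginal when the other coordinates tend to infinity. -/
theorem tendsto_df_update {d : ℕ} (ρ : Measure (Fin d → ℝ)) [IsFiniteMeasure ρ] (i : Fin d)
    (a : ℝ) :
    Tendsto (fun n : ℕ => df ρ (Function.update (fun _ => (n : ℝ) + 1) i a)) atTop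
      (𝓝 (marg ρ i a)) := by
  have hU : (⋃ n : ℕ, {y : Fin d → ℝ | ∀ j, y j ≤ Function.update (fun _ => (n : ℝ) + 1) i a j})
      = {y | y i ≤ a} := by
    ext y
    simp only [Set.mem_iUnion, Set.mem_ofPred_eq]
    constructor
    · rintro ⟨n, hn⟩
      simpa using hn i
    · intro hy
      obtain ⟨n, hn⟩ := (eventually_le_update i a y).exists
      refine ⟨n, fun j => ?_⟩
      by_cases hj : j = i
      · subst hj; simpa using hy
      · exact hn j hj
  refine (ENNReal.tendsto_toReal (measure_ne_top _ _)).comp ?_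
  rw [← hU]
  refine tendsto_measure_iUnion_atTop fun m n hmn y hy j => (hy j).trans ?_
  have : (m : ℝ) ≤ n := by exact_mod_cast hmn
  by_cases hj : j = i
  · subst hj; simp
  · simpa [Function.update_of_ne hj] using this

theorem IsExponentMeasure.ne_top {d : ℕ} {ρ υ : Measure (Fin d → ℝ)} [IsProbabilityMeasure ρ]
    (hυ : IsExponentMeasure ρ υ) (hm : HasFrechetMarginals ρ) (hs : MaxStable ρ) (i : Fin d)
    {x : Fin d → ℝ} (hx : ∀ j, 0 < x j) : υ {y | ∃ j, x j < y j} ≠ ∞ := by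
  intro h
  have h1 := hυ x hx
  have h2 := Real.log_neg (hs.df_pos hx) (hm.df_lt_one i (hx i))
  rw [h, ENNReal.toReal_top] at h1
  linarith

/-- Half-spaces `{y | a < y i}` have finite exponent measure `1 / a`. -/
theorem IsExponentMeasure.halfspace {d : ℕ} {ρ υ : Measure (Fin d → ℝ)} [IsProbabilityMeasure ρ]
    (hυ : IsExponentMeasure ρ υ) (hm : HasFrechetMarginals ρ) (hs : MaxStable ρ) (i : Fin d)
    {a : ℝ} (ha : 0 < a) : υ {y | a < y i} ≠ ∞ ∧ υ.real {y | a < y i} = 1 / a := by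
  have hpos : ∀ (n : ℕ) (j : Fin d), 0 < Function.update (fun _ => (n : ℝ) + 1) i a j := by
    intro n j
    by_cases hj : j = i
    · subst hj; simpa using ha
    · rw [Function.update_of_ne hj]; positivity
  have hI : (⋂ n : ℕ, {y : Fin d → ℝ | ∃ j, Function.update (fun _ => (n : ℝ) + 1) i a j < y j})
      = {y | a < y i} := by
    ext y
    simp only [Set.mem_iInter, Set.mem_ofPred_eq]
    constructor
    · intro h
      obtain ⟨n, hn⟩ := (eventually_le_update i a y).exists
      obtain ⟨j, hj⟩ := h n
      by_cases hji : j = i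
      · subst hji; simpa using hj
      · exact absurd hj (not_lt.2 (hn j hji))
    · exact fun hy n => ⟨i, by simpa using hy⟩
  have hfin : υ {y | a < y i} ≠ ∞ := by
    rw [← hI]
    exact measure_ne_top_of_subset (Set.iInter_subset _ 0) (hυ.ne_top hm hs i (hpos 0))
  refine ⟨hfin, ?_⟩
  have hlim : Tendsto (fun n : ℕ =>
      (υ {y : Fin d → ℝ | ∃ j, Function.update (fun _ => (n : ℝ) + 1) i a j < y j}).toReal) atTop
      (𝓝 (υ.real {y | a < y i})) := by
    refine (ENNReal.tendsto_toReal hfin).comp ?_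
    rw [← hI]
    refine tendsto_measure_iInter_atTop (fun n => MeasurableSet.nullMeasurableSet ?_) ?_
      ⟨0, hυ.ne_top hm hs i (hpos 0)⟩
    · simp only [Set.ofPred_exists]
      exact MeasurableSet.iUnion fun j =>
        measurableSet_lt measurable_const (measurable_pi_apply j)
    · rintro m n hmn y ⟨j, hj⟩
      refine ⟨j, lt_of_le_of_lt ?_ hj⟩
      have : (m : ℝ) ≤ n := by exact_mod_cast hmn
      by_cases hj : j = i
      · subst hj; simp
      · simpa [Function.update_of_ne hj] using this
  simp only [hυ _ (hpos _)] at hlim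
  have hf : marg ρ i a = Real.exp (-(1 / a)) := by rw [hm, frechet, if_pos ha]
  have hlim' := ((tendsto_df_update ρ i a).log (by rw [hf]; positivity)).neg
  rw [hf, Real.log_exp, neg_neg] at hlim'
  exact tendsto_nhds_unique hlim hlim'

/-- Exponent measure of the rectangles `(s / u, ∞) × (s / t, ∞)`. -/
theorem IsExponentMeasure.rectangle {ρ υ : Measure (Fin 2 → ℝ)} [IsProbabilityMeasure ρ]
    (hυ : IsExponentMeasure ρ υ) (hm : HasFrechetMarginals ρ) (hs : MaxStable ρ)
    {u t s : ℝ} (hu : 0 < u) (ht : 0 < t) (h0 : 0 < s) :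
    υ {y | s < u * y 0 ∧ s < t * y 1} ≠ ∞ ∧ υ.real {y | s < u * y 0 ∧ s < t * y 1} =
      s⁻¹ * (u + t + Real.log (df ρ ![1 / u, 1 / t])) := by
  have hx : ∀ i, 0 < (![1 / u, 1 / t] : Fin 2 → ℝ) i := by
    intro i; fin_cases i <;> simp [hu, ht]
  obtain ⟨f0, r0⟩ := hυ.halfspace hm hs 0 (a := s * (1 / u)) (by positivity)
  obtain ⟨f1, r1⟩ := hυ.halfspace hm hs 1 (a := s * (1 / t)) (by positivity)
  have hor := hυ (fun i => s * (![1 / u, 1 / t] : Fin 2 → ℝ) i) fun i => mul_pos h0 (hx i)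
  rw [hs s h0 _ hx, Real.log_rpow (hs.df_pos hx)] at hor
  have hset : {y : Fin 2 → ℝ | ∃ i, s * (![1 / u, 1 / t] : Fin 2 → ℝ) i < y i} =
      {y | s * (1 / u) < y 0} ∪ {y | s * (1 / t) < y 1} := by
    ext y; simp [Fin.exists_fin_two]
  have hset' : {y : Fin 2 → ℝ | s < u * y 0 ∧ s < t * y 1} =
      {y | s * (1 / u) < y 0} ∩ {y | s * (1 / t) < y 1} := by
    ext y
    simp only [Set.mem_ofPred_eq, Set.mem_inter_iff, mul_one_div, div_lt_iff₀ hu, div_lt_iff₀ ht,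
      mul_comm u, mul_comm t]
  have hmeas : MeasurableSet {y : Fin 2 → ℝ | s * (1 / t) < y 1} :=
    measurableSet_lt measurable_const (measurable_pi_apply 1)
  rw [hset] at hor
  have hsum := measureReal_union_add_inter (μ := υ) (s := {y | s * (1 / u) < y 0}) hmeas f0 f1
  rw [hset']
  refine ⟨measure_ne_top_of_subset Set.inter_subset_left f0, ?_⟩
  rw [r0, r1] at hsum
  rw [Measure.real, hor] at hsum
  have e0 : 1 / (s * (1 / u)) = s⁻¹ * u := by field_simp
  have e1 : 1 / (s * (1 / t)) = s⁻¹ * t := by field_simp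
  rw [e0, e1, one_div] at hsum
  linarith

theorem lintegral_neg_log_Ioo {C : ℝ} (hC : 0 ≤ C) :
    ∫⁻ r in Set.Ioo (0 : ℝ) 1, ENNReal.ofReal (-Real.log r * C) = ENNReal.ofReal C := by
  have hint : IntegrableOn (fun r => -Real.log r * C) (Set.Ioc (0 : ℝ) 1) := by
    rw [← intervalIntegrable_iff_integrableOn_Ioc_of_le zero_le_one]
    exact intervalIntegral.intervalIntegrable_log'.neg.mul_const C
  rw [← ofReal_integral_eq_lintegral_ofReal (hint.mono_set Set.Ioo_subset_Ioc_self)]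
  · congr 1
    rw [← integral_Ioc_eq_integral_Ioo, ← intervalIntegral.integral_of_le zero_le_one,
      intervalIntegral.integral_mul_const, intervalIntegral.integral_neg, integral_log]
    simp
  · filter_upwards [ae_restrict_mem measurableSet_Ioo] with r hr
    exact mul_nonneg (neg_nonneg.2 (Real.log_nonpos hr.1.le hr.2.le)) hC

theorem lt_exp_neg_one_div_iff {r m : ℝ} (hr : 0 < r) (hr1 : r < 1) (hm : 0 < m) :
    r < Real.exp (-(1 / m)) ↔ (-Real.log r)⁻¹ < m := by
  have : 0 < -Real.log r := neg_pos.2 (Real.log_neg hr hr1)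
  rw [← Real.log_lt_iff_lt_exp hr, lt_neg, one_div, inv_lt_comm₀ hm this]

/-- For a bivariate max-stable df `H` with unit Fréchet marginals and
exponent measure `υ`, for all `u, t > 0`:
`∫_{(0,∞)²} min(exp(-1/(u x₁)), exp(-1/(t x₂))) dυ = u + t + ln H(1/u, 1/t)`. -/
theorem stmt15 (ρH : Measure (Fin 2 → ℝ)) [IsProbabilityMeasure ρH]
    (hHm : HasFrechetMarginals ρH) (hHms : MaxStable ρH)
    (υ : Measure (Fin 2 → ℝ)) (hexp : IsExponentMeasure ρH υ) :
    ∀ u t : ℝ, 0 < u → 0 < t →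
      ∫ x in posOrthant 2,
          min (Real.exp (-(1 / (u * x 0)))) (Real.exp (-(1 / (t * x 1)))) ∂υ =
        u + t + Real.log (df ρH ![1/u, 1/t]) := by
  intro u t hu ht
  set C := u + t + Real.log (df ρH ![1/u, 1/t]) with hCdef
  have hC : 0 ≤ C := by
    have h := (hexp.rectangle hHm hHms hu ht one_pos).2
    rw [inv_one, one_mul] at h
    rw [hCdef, ← h]
    exact measureReal_nonneg
  have hmeas : MeasurableSet (posOrthant 2) := by
    simp only [posOrthant, Set.ofPred_forall]
    exact MeasurableSet.iInter fun j =>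
      measurableSet_lt measurable_const (measurable_pi_apply j)
  have hf : Measurable fun x : Fin 2 → ℝ =>
      min (Real.exp (-(1 / (u * x 0)))) (Real.exp (-(1 / (t * x 1)))) := by fun_prop
  have hf0 : ∀ x : Fin 2 → ℝ,
      0 ≤ min (Real.exp (-(1 / (u * x 0)))) (Real.exp (-(1 / (t * x 1)))) :=
    fun x => le_min (Real.exp_pos _).le (Real.exp_pos _).le
  rw [integral_eq_lintegral_of_nonneg_ae (.of_forall hf0) hf.aestronglyMeasurable,
    lintegral_eq_lintegral_meas_lt _ (.of_forall hf0) hf.aemeasurable]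
  have key : ∀ r ∈ Set.Ioi (0 : ℝ), (υ.restrict (posOrthant 2)) {x : Fin 2 → ℝ |
      r < min (Real.exp (-(1 / (u * x 0)))) (Real.exp (-(1 / (t * x 1))))} =
      (Set.Ioo (0 : ℝ) 1).indicator (fun r => ENNReal.ofReal (-Real.log r * C)) r := by
    intro r hr
    rw [Measure.restrict_apply' hmeas]
    by_cases hr1 : r < 1
    · have hl : 0 < (-Real.log r)⁻¹ := inv_pos.2 (neg_pos.2 (Real.log_neg hr hr1))
      rw [Set.indicator_of_mem (show r ∈ Set.Ioo (0 : ℝ) 1 from ⟨hr, hr1⟩)]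
      obtain ⟨hfin, hrect⟩ := hexp.rectangle hHm hHms hu ht hl
      rw [inv_inv] at hrect
      rw [← hrect, Measure.real, ENNReal.ofReal_toReal hfin]
      congr 1
      ext y
      simp only [Set.mem_inter_iff, Set.mem_ofPred_eq, posOrthant, Fin.forall_fin_two, lt_min_iff]
      constructor
      · rintro ⟨⟨h0, h1⟩, p0, p1⟩
        exact ⟨(lt_exp_neg_one_div_iff hr hr1 (mul_pos hu p0)).1 h0,
          (lt_exp_neg_one_div_iff hr hr1 (mul_pos ht p1)).1 h1⟩
      · rintro ⟨h0, h1⟩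
        have q0 := hl.trans h0
        have q1 := hl.trans h1
        exact ⟨⟨(lt_exp_neg_one_div_iff hr hr1 q0).2 h0,
          (lt_exp_neg_one_div_iff hr hr1 q1).2 h1⟩,
          pos_of_mul_pos_right q0 hu.le, pos_of_mul_pos_right q1 ht.le⟩
    · rw [Set.indicator_of_notMem fun h => hr1 h.2]
      convert measure_empty (μ := υ)
      refine Set.eq_empty_of_forall_notMem fun y hy => hr1 ?_
      have h0 : 0 < 1 / (u * y 0) := one_div_pos.2 (mul_pos hu (hy.2 0))
      exact (lt_min_iff.1 hy.1).1.trans (Real.exp_lt_one_iff.2 (neg_lt_zero.2 h0))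
  rw [setLIntegral_congr_fun measurableSet_Ioi key, lintegral_indicator measurableSet_Ioo,
    Measure.restrict_restrict measurableSet_Ioo,
    Set.inter_eq_left.2 Set.Ioo_subset_Ioi_self, lintegral_neg_log_Ioo hC, ENNReal.toReal_ofReal hC]
end

section
/- Let d ≥ 1, let (V₁,…,V_d) be a random vector whose marginal dfs H_i (i ≤ d) are continuous and satisfy H_i(t) < 1 for all t ∈ ℝ (upper endpoint ∞), and let G be a d-dimensional df with G(x₁,…,x_d) < 1 for all (x₁,…,x_d) ∈ (0,∞)^d. Then for any κ ∈ [0,∞): lim_{n→∞} n E[G(V₁,…,V_d)^{n−1}] = κ holds if and only if lim_{n→∞} n P(G(V₁,…,V_d) > 1 − 1/n) = κ holds (if either limit exists, so does the other, with the same value). Moreover, if in addition G(x₁,…,x_d) ≤ min_{1≤i≤d} H_i(x_i) for all (x₁,…,x_d) ∈ (0,∞)^d, then the common limit κ (when it exists) satisfies κ ∈ [0,1]. -/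
open MeasureTheory Filter Topology ProbabilityTheory
open scoped ENNReal

section Tauberian

variable {Ω : Type*} [MeasurableSpace Ω] {P : Measure Ω} [IsProbabilityMeasure P] {W : Ω → ℝ}

lemma integrable_continuous_comp_of_mem_Icc (hW : Measurable W) (h01 : ∀ ω, W ω ∈ Set.Icc (0 : ℝ) 1)
    {g : ℝ → ℝ} (hg : Continuous g) : Integrable (fun ω => g (W ω)) P := by
  obtain ⟨C, hC⟩ := isCompact_Icc.exists_bound_of_continuousOn (hg.continuousOn (s := Set.Icc 0 1))
  exact Integrable.of_bound (hg.measurable.comp hW).aestronglyMeasurable C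
    (ae_of_all _ fun ω => hC _ (h01 ω))

/-- Convergence of the moments gives convergence of the Karamata functionals on polynomials. -/
lemma tendsto_moment_polynomial (hW : Measurable W) (h01 : ∀ ω, W ω ∈ Set.Icc (0 : ℝ) 1) {κ : ℝ}
    (h : Tendsto (fun n : ℕ => (n : ℝ) * ∫ ω, W ω ^ (n - 1) ∂P) atTop (𝓝 κ))
    (p : Polynomial ℝ) :
    Tendsto (fun n : ℕ => (n : ℝ) * ∫ ω, W ω ^ (n - 1) * p.eval (W ω ^ n) ∂P) atTop
      (𝓝 (κ * ∫ t in (0 : ℝ)..1, p.eval t)) := by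
  induction p using Polynomial.induction_on' with
  | add p q hp hq =>
    have hint : ∀ (r : Polynomial ℝ) (n : ℕ),
        Integrable (fun ω => W ω ^ (n - 1) * r.eval (W ω ^ n)) P := fun r n =>
      integrable_continuous_comp_of_mem_Icc hW h01
        (g := fun x => x ^ (n - 1) * r.eval (x ^ n)) (by fun_prop)
    simp only [Polynomial.eval_add, mul_add]
    rw [intervalIntegral.integral_add (p.continuous.intervalIntegrable _ _)
      (q.continuous.intervalIntegrable _ _), mul_add]
    refine (hp.add hq).congr fun n => ?_
    rw [integral_add (hint p n) (hint q n), mul_add]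
  | monomial k a =>
    have hk : Tendsto (fun n : ℕ => (k + 1) * n) atTop atTop :=
      tendsto_id.const_mul_atTop' k.succ_pos
    have key := (h.comp hk).const_mul (a / (k + 1))
    have hlim : a / (k + 1) * κ = κ * ∫ t in (0 : ℝ)..1, (Polynomial.monomial k a).eval t := by
      simp only [Polynomial.eval_monomial, intervalIntegral.integral_const_mul, integral_pow]
      simp
      ring
    rw [← hlim]
    refine key.congr' ?_
    filter_upwards [eventually_ge_atTop 1] with n hn
    have he : (k + 1) * n - 1 = (n - 1) + n * k := by
      obtain ⟨m, rfl⟩ := Nat.exists_eq_add_of_le hn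
      have : (k + 1) * (1 + m) = (m + (1 + m) * k) + 1 := by ring
      rw [this]
      simp
    have hpw : ∀ ω, W ω ^ (n - 1) * (Polynomial.monomial k a).eval (W ω ^ n)
        = a * W ω ^ ((k + 1) * n - 1) := fun ω => by
      rw [he, pow_add, pow_mul, Polynomial.eval_monomial]
      ring
    simp only [Function.comp_apply, hpw, integral_const_mul]
    push_cast
    field_simp

/-- Karamata's step: convergence of the moments gives convergence against continuous functions. -/
lemma tendsto_moment_continuous (hW : Measurable W) (h01 : ∀ ω, W ω ∈ Set.Icc (0 : ℝ) 1) {κ : ℝ}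
    (hκ : 0 ≤ κ)
    (h : Tendsto (fun n : ℕ => (n : ℝ) * ∫ ω, W ω ^ (n - 1) ∂P) atTop (𝓝 κ))
    {f : ℝ → ℝ} (hf : Continuous f) :
    Tendsto (fun n : ℕ => (n : ℝ) * ∫ ω, W ω ^ (n - 1) * f (W ω ^ n) ∂P) atTop
      (𝓝 (κ * ∫ t in (0 : ℝ)..1, f t)) := by
  rw [Metric.tendsto_nhds]
  intro ε hε
  set δ := ε / (2 * κ + 3) with hδ
  have hδ0 : 0 < δ := by positivity
  obtain ⟨p, hp⟩ := exists_polynomial_near_of_continuousOn 0 1 f hf.continuousOn δ hδ0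
  have hint : ∀ (g : ℝ → ℝ) (_ : Continuous g) (n : ℕ),
      Integrable (fun ω => W ω ^ (n - 1) * g (W ω ^ n)) P := fun g hg n =>
    integrable_continuous_comp_of_mem_Icc hW h01 (g := fun x => x ^ (n - 1) * g (x ^ n))
      (by fun_prop)
  have hdist : ∀ n : ℕ, |(n : ℝ) * ∫ ω, W ω ^ (n - 1) * f (W ω ^ n) ∂P
      - (n : ℝ) * ∫ ω, W ω ^ (n - 1) * p.eval (W ω ^ n) ∂P|
      ≤ δ * ((n : ℝ) * ∫ ω, W ω ^ (n - 1) ∂P) := fun n => by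
    rw [← mul_sub, ← integral_sub (hint f hf n) (hint _ p.continuous n), abs_mul, Nat.abs_cast,
      mul_left_comm, ← integral_const_mul]
    refine mul_le_mul_of_nonneg_left ?_ n.cast_nonneg
    refine (abs_integral_le_integral_abs).trans (integral_mono_of_nonneg
      (ae_of_all _ fun _ => abs_nonneg _)
      (integrable_continuous_comp_of_mem_Icc hW h01 (g := fun x => δ * x ^ (n - 1)) (by fun_prop))
      (ae_of_all _ fun ω => ?_))
    have h0 := (h01 ω).1
    simp only
    rw [← mul_sub, abs_mul, abs_of_nonneg (pow_nonneg h0 _), mul_comm, abs_sub_comm]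
    exact mul_le_mul_of_nonneg_right
      (hp _ ⟨pow_nonneg h0 _, pow_le_one₀ h0 (h01 ω).2⟩).le (pow_nonneg h0 _)
  have hI : |κ * (∫ t in (0 : ℝ)..1, p.eval t) - κ * ∫ t in (0 : ℝ)..1, f t| ≤ κ * δ := by
    rw [← mul_sub, abs_mul, abs_of_nonneg hκ, ← intervalIntegral.integral_sub
      (p.continuous.intervalIntegrable _ _) (hf.intervalIntegrable _ _)]
    refine mul_le_mul_of_nonneg_left ?_ hκ
    have := intervalIntegral.norm_integral_le_of_norm_le_const (a := (0 : ℝ)) (b := 1)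
      (f := fun t => p.eval t - f t) (C := δ) (fun t ht => by
        rw [Set.uIoc_of_le zero_le_one] at ht
        exact (hp t ⟨ht.1.le, ht.2⟩).le)
    simpa using this
  filter_upwards [Metric.tendsto_nhds.1 (tendsto_moment_polynomial hW h01 h p) δ hδ0,
    Metric.tendsto_nhds.1 h 1 one_pos] with n h1 h2
  rw [Real.dist_eq, abs_lt] at h1 h2 ⊢
  have h3 := abs_le.1 (hdist n)
  have h4 := abs_le.1 hI
  have h5 : δ * ((n : ℝ) * ∫ ω, W ω ^ (n - 1) ∂P) ≤ δ * (κ + 1) :=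
    mul_le_mul_of_nonneg_left (by linarith) hδ0.le
  have h6 : ε = δ * (2 * κ + 3) := by rw [hδ]; field_simp
  constructor <;> nlinarith


/-- A continuous function interpolating between `0` on `(-∞, a]` and `t⁻¹` on `[b, ∞)`. -/
noncomputable def invRamp (a b t : ℝ) : ℝ := max 0 (min 1 ((t - a) / (b - a))) / max t a

lemma continuous_invRamp {a : ℝ} (b : ℝ) (ha : 0 < a) : Continuous (invRamp a b) := by
  unfold invRamp
  exact Continuous.div (by fun_prop) (by fun_prop) fun t => (lt_max_of_lt_right ha).ne'

lemma invRamp_nonneg {a : ℝ} (b t : ℝ) (ha : 0 < a) : 0 ≤ invRamp a b t :=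
  div_nonneg (le_max_left _ _) (ha.le.trans (le_max_right _ _))

lemma invRamp_of_le {a b t : ℝ} (hab : a < b) (ht : t ≤ a) : invRamp a b t = 0 := by
  have : (t - a) / (b - a) ≤ 0 := div_nonpos_of_nonpos_of_nonneg (by linarith) (by linarith)
  rw [invRamp, max_eq_left ((min_le_right _ _).trans this), zero_div]

lemma invRamp_of_ge {a b t : ℝ} (hab : a < b) (ht : b ≤ t) : invRamp a b t = t⁻¹ := by
  have : 1 ≤ (t - a) / (b - a) := by rw [le_div_iff₀ (by linarith)]; linarith
  rw [invRamp, min_eq_left this, max_eq_right zero_le_one, max_eq_left (by linarith), one_div]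

lemma invRamp_le_inv {a b t : ℝ} (ht : 0 < t) : invRamp a b t ≤ t⁻¹ := by
  rw [invRamp, ← one_div]
  exact div_le_div₀ zero_le_one (max_le zero_le_one (min_le_left _ _)) ht (le_max_left _ _)

lemma integral_invRamp_le {a b : ℝ} (ha : 0 < a) (hab : a < b) (hb : b < 1) :
    ∫ t in (0 : ℝ)..1, invRamp a b t ≤ -Real.log a := by
  have hc := continuous_invRamp b ha
  rw [← intervalIntegral.integral_add_adjacent_intervals (hc.intervalIntegrable 0 a)
    (hc.intervalIntegrable a 1)]
  have h0 : ∫ t in (0 : ℝ)..a, invRamp a b t = 0 := by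
    rw [intervalIntegral.integral_congr (g := fun _ => (0 : ℝ)) fun t ht => ?_]
    · simp
    · rw [Set.uIcc_of_le ha.le] at ht
      exact invRamp_of_le hab ht.2
  have h1 : ∫ t in a..1, invRamp a b t ≤ ∫ t in a..1, t⁻¹ := by
    refine intervalIntegral.integral_mono_on (by linarith) (hc.intervalIntegrable _ _)
      (intervalIntegral.intervalIntegrable_inv (fun t ht => ?_) continuousOn_id) fun t ht =>
        invRamp_le_inv (ha.trans_le ht.1)
    rw [Set.uIcc_of_le (by linarith)] at ht
    exact (ha.trans_le ht.1).ne'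
  rw [integral_inv_of_pos ha one_pos, one_div, Real.log_inv] at h1
  linarith

lemma le_integral_invRamp {a b : ℝ} (ha : 0 < a) (hab : a < b) (hb : b < 1) :
    -Real.log b ≤ ∫ t in (0 : ℝ)..1, invRamp a b t := by
  have hc := continuous_invRamp b ha
  have hb0 : 0 < b := ha.trans hab
  rw [← intervalIntegral.integral_add_adjacent_intervals (hc.intervalIntegrable 0 b)
    (hc.intervalIntegrable b 1)]
  have h0 : 0 ≤ ∫ t in (0 : ℝ)..b, invRamp a b t :=
    intervalIntegral.integral_nonneg hb0.le fun t _ => invRamp_nonneg b t ha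
  have h1 : ∫ t in b..1, invRamp a b t = ∫ t in b..1, t⁻¹ :=
    intervalIntegral.integral_congr fun t ht => by
      rw [Set.uIcc_of_le hb.le] at ht
      exact invRamp_of_ge hab ht.1
  rw [h1, integral_inv_of_pos hb0 one_pos, one_div, Real.log_inv]
  linarith

lemma real_setOf_lt_eq_integral {μ : Measure Ω} (hW : Measurable W) (c : ℝ) :
    μ.real {ω | c < W ω} = ∫ ω, {ω | c < W ω}.indicator (fun _ => (1 : ℝ)) ω ∂μ := by
  rw [integral_indicator_const _ (measurableSet_lt measurable_const hW), smul_eq_mul, mul_one]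

/-- Tauberian direction: the moments control the tail at the upper endpoint. -/
lemma tendsto_tail_of_tendsto_moment (hW : Measurable W) (h01 : ∀ ω, W ω ∈ Set.Icc (0 : ℝ) 1)
    {κ : ℝ} (hκ : 0 ≤ κ)
    (h : Tendsto (fun n : ℕ => (n : ℝ) * ∫ ω, W ω ^ (n - 1) ∂P) atTop (𝓝 κ)) :
    Tendsto (fun n : ℕ => (n : ℝ) * P.real {ω | 1 - 1 / (n : ℝ) < W ω}) atTop (𝓝 κ) := by
  have hind : ∀ c : ℝ, Integrable ({ω | c < W ω}.indicator (fun _ => (1 : ℝ))) P := fun c =>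
    (integrable_const 1).indicator (measurableSet_lt measurable_const hW)
  have hint : ∀ (g : ℝ → ℝ) (_ : Continuous g) (n : ℕ),
      Integrable (fun ω => W ω ^ (n - 1) * g (W ω ^ n)) P := fun g hg n =>
    integrable_continuous_comp_of_mem_Icc hW h01 (g := fun x => x ^ (n - 1) * g (x ^ n))
      (by fun_prop)
  have hmul : ∀ {x : ℝ} {n : ℕ}, 0 < x → 1 ≤ n → x ^ (n - 1) * (x ^ n)⁻¹ = x⁻¹ := by
    intro x n hx hn
    obtain ⟨m, rfl⟩ := Nat.exists_eq_add_of_le' hn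
    rw [Nat.add_sub_cancel, pow_succ]
    field_simp
  rw [tendsto_order]
  constructor
  · intro c hc
    obtain ⟨δ, hδ0, hδ1, hδ⟩ : ∃ δ : ℝ, 0 < δ ∧ δ < 1 ∧ c < κ * (1 - δ) := by
      have hcont : Tendsto (fun δ : ℝ => κ * (1 - δ)) (𝓝[>] 0) (𝓝 κ) := by
        have : Continuous fun δ : ℝ => κ * (1 - δ) := by fun_prop
        simpa using (this.tendsto 0).mono_left nhdsWithin_le_nhds
      obtain ⟨δ, h1, h2⟩ := ((hcont.eventually_const_lt hc).and
        (Ioo_mem_nhdsGT (zero_lt_one' ℝ))).exists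
      exact ⟨δ, h2.1, h2.2, h1⟩
    have ha : 0 < Real.exp (-1) := Real.exp_pos _
    have hab : Real.exp (-1) < Real.exp (-1 + δ) := Real.exp_lt_exp.2 (by linarith)
    have hb : Real.exp (-1 + δ) < 1 := Real.exp_lt_one_iff.2 (by linarith)
    have hf := continuous_invRamp (Real.exp (-1 + δ)) ha
    have hI := le_integral_invRamp ha hab hb
    rw [Real.log_exp] at hI
    have hlim := (tendsto_moment_continuous hW h01 hκ h hf)
    have hone : Tendsto (fun n : ℕ => 1 - 1 / (n : ℝ)) atTop (𝓝 1) := by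
      simpa using tendsto_one_div_atTop_nhds_zero_nat.const_sub (1 : ℝ)
    have hlim' := hone.mul hlim
    rw [one_mul] at hlim'
    filter_upwards [hlim'.eventually_const_lt (show c < _ from
      hδ.trans_le (mul_le_mul_of_nonneg_left (by linarith) hκ)), eventually_ge_atTop 1]
      with n hn hn1
    refine hn.trans_le ?_
    have hn1' : (1 : ℝ) ≤ n := by exact_mod_cast hn1
    have hs0 : 0 ≤ 1 - 1 / (n : ℝ) := by
      rw [sub_nonneg, div_le_one (by linarith)]; exact hn1'
    rw [mul_left_comm, real_setOf_lt_eq_integral hW, ← integral_const_mul]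
    refine mul_le_mul_of_nonneg_left (integral_mono ((hint _ hf n).const_mul _) (hind _)
      fun ω => ?_) n.cast_nonneg
    by_cases hω : 1 - 1 / (n : ℝ) < W ω
    · rw [Set.indicator_of_mem (show ω ∈ {ω | 1 - 1 / (n : ℝ) < W ω} from hω)]
      have hpos : 0 < W ω := hs0.trans_lt hω
      calc (1 - 1 / (n : ℝ)) * (W ω ^ (n - 1) * invRamp _ _ (W ω ^ n))
          ≤ W ω * (W ω ^ (n - 1) * (W ω ^ n)⁻¹) := by
            gcongr
            exact mul_nonneg (by positivity) (invRamp_nonneg _ _ ha)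
            exact invRamp_le_inv (by positivity)
        _ = 1 := by rw [hmul hpos hn1, mul_inv_cancel₀ hpos.ne']
    · rw [Set.indicator_of_notMem (show ω ∉ {ω | 1 - 1 / (n : ℝ) < W ω} from hω)]
      have hle : W ω ^ n ≤ Real.exp (-1) :=
        (pow_le_pow_left₀ (h01 ω).1 (not_lt.1 hω) n).trans (Real.one_sub_div_pow_le_exp_neg hn1')
      simp [invRamp_of_le hab hle]
  · intro c hc
    obtain ⟨δ, hδ0, hδ⟩ : ∃ δ : ℝ, 0 < δ ∧ κ * (1 + 2 * δ) < c := by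
      have hcont : Tendsto (fun δ : ℝ => κ * (1 + 2 * δ)) (𝓝[>] 0) (𝓝 κ) := by
        have : Continuous fun δ : ℝ => κ * (1 + 2 * δ) := by fun_prop
        simpa using (this.tendsto 0).mono_left nhdsWithin_le_nhds
      obtain ⟨δ, h1, h2⟩ := ((hcont.eventually_lt_const hc).and self_mem_nhdsWithin).exists
      exact ⟨δ, h2, h1⟩
    have ha : 0 < Real.exp (-(1 + 2 * δ)) := Real.exp_pos _
    have hab : Real.exp (-(1 + 2 * δ)) < Real.exp (-(1 + δ)) := Real.exp_lt_exp.2 (by linarith)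
    have hb : Real.exp (-(1 + δ)) < 1 := Real.exp_lt_one_iff.2 (by linarith)
    have hb' : Real.exp (-(1 + δ)) < Real.exp (-1) := Real.exp_lt_exp.2 (by linarith)
    have hf := continuous_invRamp (Real.exp (-(1 + δ))) ha
    have hI := integral_invRamp_le ha hab hb
    rw [Real.log_exp, neg_neg] at hI
    have hlim := (tendsto_moment_continuous hW h01 hκ h hf)
    filter_upwards [hlim.eventually_lt_const (show _ < c from
      (mul_le_mul_of_nonneg_left hI hκ).trans_lt hδ), eventually_ge_atTop 1,
      (Real.tendsto_one_add_div_pow_exp (-1)).eventually_const_lt hb'] with n hn hn1 hnb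
    refine lt_of_le_of_lt ?_ hn
    have hn1' : (1 : ℝ) ≤ n := by exact_mod_cast hn1
    have hs0 : 0 ≤ 1 - 1 / (n : ℝ) := by
      rw [sub_nonneg, div_le_one (by linarith)]; exact hn1'
    rw [real_setOf_lt_eq_integral hW]
    refine mul_le_mul_of_nonneg_left (integral_mono (hind _) (hint _ hf n)
      fun ω => ?_) n.cast_nonneg
    by_cases hω : 1 - 1 / (n : ℝ) < W ω
    · rw [Set.indicator_of_mem (show ω ∈ {ω | 1 - 1 / (n : ℝ) < W ω} from hω)]
      have hpos : 0 < W ω := hs0.trans_lt hω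
      have hge : Real.exp (-(1 + δ)) ≤ W ω ^ n := by
        rw [neg_div, ← sub_eq_add_neg] at hnb
        exact hnb.le.trans (pow_le_pow_left₀ hs0 hω.le n)
      simp only
      rw [invRamp_of_ge hab hge, hmul hpos hn1]
      exact (one_le_inv₀ hpos).2 (h01 ω).2
    · rw [Set.indicator_of_notMem (show ω ∉ {ω | 1 - 1 / (n : ℝ) < W ω} from hω)]
      exact mul_nonneg (pow_nonneg (h01 ω).1 _) (invRamp_nonneg _ _ ha)

lemma antitone_real_setOf_lt : Antitone fun s : ℝ => P.real {ω | s < W ω} := fun _ _ hst =>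
  measureReal_mono fun _ hω => lt_of_le_of_lt hst hω

lemma integral_pow_succ_eq_integral_tail (hW : Measurable W)
    (h01 : ∀ ω, W ω ∈ Set.Icc (0 : ℝ) 1) (m : ℕ) :
    ∫ ω, W ω ^ (m + 1) ∂P = ∫ s in (0 : ℝ)..1, P.real {ω | s < W ω} * ((m + 1) * s ^ m) := by
  have hg : Continuous fun s : ℝ => ((m : ℝ) + 1) * s ^ m := by fun_prop
  have hmeas : Measurable fun s : ℝ => P.real {ω | s < W ω} := antitone_real_setOf_lt.measurable
  have hprod : Measurable fun s : ℝ => P.real {ω | s < W ω} * (((m : ℝ) + 1) * s ^ m) :=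
    hmeas.mul hg.measurable
  have key := lintegral_comp_eq_lintegral_meas_lt_mul P (f := W)
    (g := fun s : ℝ => ((m : ℝ) + 1) * s ^ m) (ae_of_all _ fun ω => (h01 ω).1) hW.aemeasurable
    (fun t _ => hg.intervalIntegrable _ _)
    ((ae_restrict_iff' measurableSet_Ioi).2 (ae_of_all _ fun t (ht : 0 < t) => by positivity))
  have hprim : ∀ x : ℝ, ∫ s in (0 : ℝ)..x, ((m : ℝ) + 1) * s ^ m = x ^ (m + 1) := fun x => by
    rw [intervalIntegral.integral_const_mul, integral_pow]
    field_simp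
    simp
  simp only [hprim] at key
  rw [intervalIntegral.integral_of_le zero_le_one, integral_eq_lintegral_of_nonneg_ae
    (ae_of_all _ fun ω => pow_nonneg (h01 ω).1 _) (hW.pow_const _).aestronglyMeasurable,
    integral_eq_lintegral_of_nonneg_ae _ hprod.aestronglyMeasurable, key]
  · congr 1
    rw [← lintegral_indicator measurableSet_Ioi, ← lintegral_indicator measurableSet_Ioc]
    refine lintegral_congr fun t => ?_
    by_cases h0 : 0 < t
    · rw [Set.indicator_of_mem (show t ∈ Set.Ioi 0 from h0)]
      by_cases h1 : t ≤ 1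
      · rw [Set.indicator_of_mem (show t ∈ Set.Ioc 0 1 from ⟨h0, h1⟩),
          ENNReal.ofReal_mul measureReal_nonneg, ofReal_measureReal]
      · rw [Set.indicator_of_notMem fun h => h1 h.2]
        have : {ω | t < W ω} = ∅ := by
          ext ω
          simpa using (h01 ω).2.trans (not_le.1 h1).le
        simp [this]
    · rw [Set.indicator_of_notMem (show t ∉ Set.Ioi 0 from h0),
        Set.indicator_of_notMem fun h => h0 h.1]
  · refine (ae_restrict_iff' measurableSet_Ioc).2 (ae_of_all _ fun t ht => ?_)
    have := ht.1
    exact mul_nonneg measureReal_nonneg (by positivity)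

lemma exists_abs_tail_sub_le {T : ℝ → ℝ} (hT : Antitone T) (hT0 : ∀ s, 0 ≤ T s) {κ : ℝ}
    (h : Tendsto (fun n : ℕ => (n : ℝ) * T (1 - 1 / (n : ℝ))) atTop (𝓝 κ))
    {ε : ℝ} (hε : 0 < ε) :
    ∃ s₀ < 1, ∀ s, s₀ ≤ s → s < 1 → |T s - κ * (1 - s)| ≤ ε * (1 - s) := by
  have hup : Tendsto (fun n : ℕ => ((n : ℝ) + 1) * T (1 - 1 / (n : ℝ))) atTop (𝓝 κ) := by
    have h0 := tendsto_one_div_atTop_nhds_zero_nat (𝕜 := ℝ)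
    have := h.add (h0.mul h)
    rw [zero_mul, add_zero] at this
    refine this.congr' ?_
    filter_upwards [eventually_ge_atTop 1] with n hn
    have : (n : ℝ) ≠ 0 := by positivity
    field_simp
  have hlow : Tendsto (fun n : ℕ => (n : ℝ) * T (1 - 1 / ((n : ℝ) + 1))) atTop (𝓝 κ) := by
    have h0 := tendsto_one_div_add_atTop_nhds_zero_nat (𝕜 := ℝ)
    have h1 : Tendsto (fun n : ℕ => ((n : ℝ) + 1) * T (1 - 1 / ((n : ℝ) + 1))) atTop (𝓝 κ) := by
      refine (h.comp (tendsto_add_atTop_nat 1)).congr fun n => ?_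
      simp
    have := h1.sub (h0.mul h1)
    rw [zero_mul, sub_zero] at this
    refine this.congr fun n => ?_
    field_simp
    ring
  obtain ⟨N, hN⟩ := eventually_atTop.1 ((hup.eventually_lt_const (lt_add_of_pos_right κ hε)).and
    (hlow.eventually_const_lt (sub_lt_self κ hε)))
  refine ⟨1 - 1 / ((N : ℝ) + 1), sub_lt_self _ (by positivity), fun s hs hs1 => ?_⟩
  have hs' : 0 < 1 - s := by linarith
  set n := ⌊1 / (1 - s)⌋₊ with hn
  have hx : (N : ℝ) + 1 ≤ 1 / (1 - s) := by
    rw [le_one_div (by positivity) hs']; linarith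
  have hnN : N + 1 ≤ n := Nat.le_floor (by exact_mod_cast hx)
  have hn0 : (0 : ℝ) < n := by exact_mod_cast (Nat.succ_pos N).trans_le hnN
  have hle : (n : ℝ) ≤ 1 / (1 - s) := Nat.floor_le (by positivity)
  have hlt : 1 / (1 - s) < (n : ℝ) + 1 := Nat.lt_floor_add_one _
  obtain ⟨h1, h2⟩ := hN n (by omega)
  have hsl : T s ≤ T (1 - 1 / (n : ℝ)) := hT (by
    have := (le_one_div hn0 hs').1 hle
    linarith)
  have hsu : T (1 - 1 / ((n : ℝ) + 1)) ≤ T s := hT (by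
    have := (one_div_lt hs' (by positivity)).1 hlt
    linarith)
  rw [le_div_iff₀ hs'] at hle
  rw [div_lt_iff₀ hs'] at hlt
  have hTs := hT0 s
  have hA := hT0 (1 - 1 / (n : ℝ))
  have hB := hT0 (1 - 1 / ((n : ℝ) + 1))
  rw [abs_le]
  constructor
  · have e1 : T (1 - 1 / ((n : ℝ) + 1)) * (n * (1 - s)) ≤ T s * 1 :=
      mul_le_mul hsu hle (by positivity) hTs
    nlinarith [mul_lt_mul_of_pos_right h2 hs']
  · have e1 : T s * 1 ≤ T (1 - 1 / (n : ℝ)) * (((n : ℝ) + 1) * (1 - s)) :=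
      mul_le_mul hsl hlt.le zero_le_one hA
    nlinarith [mul_lt_mul_of_pos_right h1 hs']

/-- Abelian direction: the tail at the upper endpoint controls the moments. -/
lemma tendsto_moment_of_tendsto_tail (hW : Measurable W) (h01 : ∀ ω, W ω ∈ Set.Icc (0 : ℝ) 1)
    {κ : ℝ} (hκ : 0 ≤ κ)
    (h : Tendsto (fun n : ℕ => (n : ℝ) * P.real {ω | 1 - 1 / (n : ℝ) < W ω}) atTop (𝓝 κ)) :
    Tendsto (fun n : ℕ => (n : ℝ) * ∫ ω, W ω ^ (n - 1) ∂P) atTop (𝓝 κ) := by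
  set T : ℝ → ℝ := fun s => P.real {ω | s < W ω} with hTdef
  have hT : Antitone T := antitone_real_setOf_lt
  have hT1 : ∀ s, T s ≤ 1 := fun s => measureReal_le_one
  have hT0 : ∀ s, 0 ≤ T s := fun s => measureReal_nonneg
  have hTend : T 1 = 0 := by
    have : {ω | 1 < W ω} = ∅ := by
      ext ω
      simpa using (h01 ω).2
    simp [hTdef, this]
  rw [← tendsto_add_atTop_iff_nat 2, Metric.tendsto_nhds]
  intro ε hε
  obtain ⟨s₀, hs₀, hs⟩ := exists_abs_tail_sub_le hT hT0 h (half_pos hε)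
  set K : ℝ := (1 + κ) / (1 - s₀) ^ 2 with hK
  have hs₀' : 0 < 1 - s₀ := by linarith
  have hK0 : 0 ≤ K := by positivity
  have hbound : ∀ s ∈ Set.Ioc (0 : ℝ) 1,
      |T s - κ * (1 - s)| ≤ ε / 2 * (1 - s) + K * (1 - s) ^ 2 := by
    rintro s ⟨hs0, hs1⟩
    rcases hs1.eq_or_lt with rfl | hs1
    · simp [hTend]
    rcases le_total s₀ s with hle | hle
    · exact (hs s hle hs1).trans (le_add_of_nonneg_right (by positivity))
    · have h1 : |T s - κ * (1 - s)| ≤ 1 + κ := by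
        rw [abs_le]
        constructor <;>
          nlinarith [hT1 s, hT0 s, mul_nonneg hκ hs0.le, mul_nonneg hκ (sub_pos.2 hs1).le]
      have h2 : 1 + κ ≤ K * (1 - s) ^ 2 := by
        have : 1 + κ = K * (1 - s₀) ^ 2 := by rw [hK]; field_simp
        rw [this]
        gcongr
      have := mul_pos (half_pos hε) (sub_pos.2 hs1)
      linarith
  have hlim : Tendsto (fun m : ℕ => ε / 2 + 2 * K / ((m : ℝ) + 3)) atTop (𝓝 (ε / 2)) := by
    have h3 : Tendsto (fun m : ℕ => (m : ℝ) + 3) atTop atTop :=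
      tendsto_atTop_add_const_right _ _ tendsto_natCast_atTop_atTop
    simpa using (h3.const_div_atTop (2 * K)).const_add (ε / 2)
  filter_upwards [hlim.eventually_lt_const (half_lt_self hε)] with m hm
  refine lt_of_le_of_lt ?_ hm
  have hlin : ∀ c : ℝ, ∫ s in (0 : ℝ)..1, ((m : ℝ) + 2) * ((m + 1) * s ^ m) * (c * (1 - s)) = c :=
    fun c => by
      have : ∀ s : ℝ, ((m : ℝ) + 2) * ((m + 1) * s ^ m) * (c * (1 - s))
          = c * (m + 2) * (m + 1) * (s ^ m - s ^ (m + 1)) := fun s => by ring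
      simp only [this, intervalIntegral.integral_const_mul]
      rw [intervalIntegral.integral_sub ((continuous_pow _).intervalIntegrable _ _)
        ((continuous_pow _).intervalIntegrable _ _), integral_pow, integral_pow]
      push_cast
      simp
      field_simp
      ring
  have hquad : ∫ s in (0 : ℝ)..1, ((m : ℝ) + 2) * ((m + 1) * s ^ m) * (K * (1 - s) ^ 2)
      = 2 * K / (m + 3) := by
    have : ∀ s : ℝ, ((m : ℝ) + 2) * ((m + 1) * s ^ m) * (K * (1 - s) ^ 2)
        = K * (m + 2) * (m + 1) * (s ^ m - 2 * s ^ (m + 1) + s ^ (m + 2)) := fun s => by ring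
    simp only [this, intervalIntegral.integral_const_mul]
    rw [intervalIntegral.integral_add (Continuous.intervalIntegrable (by fun_prop) _ _)
      (Continuous.intervalIntegrable (by fun_prop) _ _),
      intervalIntegral.integral_sub (Continuous.intervalIntegrable (by fun_prop) _ _)
      (Continuous.intervalIntegrable (by fun_prop) _ _), intervalIntegral.integral_const_mul,
      integral_pow, integral_pow, integral_pow]
    push_cast
    simp
    field_simp
    ring
  have hTi : IntervalIntegrable (fun s => ((m : ℝ) + 2) * ((m + 1) * s ^ m) * T s) volume 0 1 :=
    hT.intervalIntegrable.continuousOn_mul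
      (f := T) (g := fun s : ℝ => ((m : ℝ) + 2) * ((m + 1) * s ^ m)) (by fun_prop)
  have hdiff : ((m + 2 : ℕ) : ℝ) * ∫ ω, W ω ^ (m + 2 - 1) ∂P - κ
      = ∫ s in (0 : ℝ)..1, ((m : ℝ) + 2) * ((m + 1) * s ^ m) * (T s - κ * (1 - s)) := by
    simp only [mul_sub _ (T _)]
    rw [intervalIntegral.integral_sub hTi
      (Continuous.intervalIntegrable (u := fun s : ℝ =>
        ((m : ℝ) + 2) * ((m + 1) * s ^ m) * (κ * (1 - s))) (by fun_prop) _ _), hlin,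
      show m + 2 - 1 = m + 1 from rfl, integral_pow_succ_eq_integral_tail hW h01,
      ← intervalIntegral.integral_const_mul]
    push_cast
    congr 1
    refine intervalIntegral.integral_congr fun s _ => ?_
    simp only [hTdef]
    ring
  have hcont : Continuous fun s : ℝ => ((m : ℝ) + 2) * ((m + 1) * s ^ m) * (ε / 2 * (1 - s))
      + ((m : ℝ) + 2) * ((m + 1) * s ^ m) * (K * (1 - s) ^ 2) := by fun_prop
  rw [Real.dist_eq, hdiff, ← Real.norm_eq_abs]
  calc _ ≤ ∫ s in (0 : ℝ)..1, (((m : ℝ) + 2) * ((m + 1) * s ^ m) * (ε / 2 * (1 - s))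
          + ((m : ℝ) + 2) * ((m + 1) * s ^ m) * (K * (1 - s) ^ 2)) := by
        refine intervalIntegral.norm_integral_le_of_norm_le zero_le_one (ae_of_all _ fun s hs => ?_)
          (hcont.intervalIntegrable _ _)
        have := hs.1
        rw [norm_mul, Real.norm_of_nonneg (by positivity), ← mul_add]
        exact mul_le_mul_of_nonneg_left (hbound s hs) (by positivity)
    _ = ε / 2 + 2 * K / (m + 3) := by
        rw [intervalIntegral.integral_add (Continuous.intervalIntegrable (by fun_prop) _ _)
          (Continuous.intervalIntegrable (by fun_prop) _ _), hlin, hquad]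

end Tauberian

section DistributionFunction

variable {d : ℕ}

lemma measurable_df (τ : Measure (Fin d → ℝ)) [SFinite τ] : Measurable (df τ) := by
  have hs : MeasurableSet {p : (Fin d → ℝ) × (Fin d → ℝ) | p.2 ≤ p.1} :=
    measurableSet_le measurable_snd measurable_fst
  exact (measurable_measure_prodMk_left hs).ennreal_toReal

lemma df_mono_s16 (τ : Measure (Fin d → ℝ)) [IsFiniteMeasure τ] : Monotone (df τ) := fun _ _ hxy =>
  measureReal_mono fun _ hz i => (hz i).trans (hxy i)

lemma df_mem_Icc (τ : Measure (Fin d → ℝ)) [IsProbabilityMeasure τ] (x : Fin d → ℝ) :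
    df τ x ∈ Set.Icc (0 : ℝ) 1 :=
  ⟨ENNReal.toReal_nonneg, measureReal_le_one⟩

/-- The probability integral transform bound at levels above `F a`. -/
lemma real_setOf_lt_cdf_comp_le {Ω : Type*} [MeasurableSpace Ω] {P : Measure Ω}
    [IsProbabilityMeasure P] {X : Ω → ℝ} (hX : Measurable X) {F : ℝ → ℝ}
    (hF : ∀ t, F t = P.real {ω | X ω ≤ t}) (hFc : Continuous F) {a u : ℝ} (hau : F a ≤ u)
    (hu : u < 1) : P.real {ω | u < F (X ω)} ≤ 1 - u := by
  have := Measure.isProbabilityMeasure_map hX.aemeasurable (μ := P)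
  have hcdf : F = cdf (P.map X) := by
    ext t
    rw [hF, cdf_eq_real, map_measureReal_apply hX measurableSet_Iic]
    rfl
  have hlim : Tendsto F atTop (𝓝 1) := hcdf ▸ tendsto_cdf_atTop _
  have hmono : Monotone F := hcdf ▸ monotone_cdf _
  obtain ⟨b, hb⟩ := (hlim.eventually_const_lt hu).exists
  obtain ⟨t, -, rfl⟩ : u ∈ F '' Set.univ :=
    isPreconnected_univ.intermediate_value (Set.mem_univ a) (Set.mem_univ b) hFc.continuousOn
      ⟨hau, hb.le⟩
  have hsub : {ω | F t < F (X ω)} ⊆ {ω | X ω ≤ t}ᶜ := fun ω hω hle =>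
    (hmono hle).not_gt hω
  refine (measureReal_mono hsub).trans_eq ?_
  rw [probReal_compl_eq_one_sub (measurableSet_le hX measurable_const), hF]

end DistributionFunction

/-- If `(V₁,…,V_d)` has continuous marginal dfs `H_i` with `H_i(t) < 1`
for all `t` and `G` is a `d`-dimensional df with `G < 1` on `(0,∞)^d`, then for `κ ≥ 0`,
`lim_n n E[G(V)^{n-1}] = κ` iff `lim_n n P(G(V) > 1 - 1/n) = κ`; moreover, if also
`G(x) ≤ min_i H_i(x_i)` on `(0,∞)^d`, then the common limit satisfies `κ ≤ 1`. -/
theorem stmt16 {d : ℕ} (hd : 1 ≤ d)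
    {Ω : Type*} [MeasurableSpace Ω] (P : Measure Ω) [IsProbabilityMeasure P]
    (V : Ω → Fin d → ℝ) (hVmeas : Measurable V)
    (Hm : Fin d → ℝ → ℝ)
    (hHmdef : ∀ (i : Fin d) (t : ℝ), Hm i t = (P {ω | V ω i ≤ t}).toReal)
    (hHmcont : ∀ i, Continuous (Hm i))
    (hHmlt : ∀ (i : Fin d) (t : ℝ), Hm i t < 1)
    (G : (Fin d → ℝ) → ℝ)
    (hGdf : ∃ τ : Measure (Fin d → ℝ), IsProbabilityMeasure τ ∧ ∀ x, df τ x = G x)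
    (hGlt : ∀ x : Fin d → ℝ, (∀ i, 0 < x i) → G x < 1)
    (κ : ℝ) (hκ : 0 ≤ κ) :
    (Tendsto (fun n : ℕ => (n : ℝ) * ∫ ω, (G (V ω)) ^ (n - 1) ∂P) atTop (𝓝 κ) ↔
      Tendsto (fun n : ℕ => (n : ℝ) * (P {ω | 1 - 1 / (n : ℝ) < G (V ω)}).toReal)
        atTop (𝓝 κ)) ∧
    ((∀ x : Fin d → ℝ, (∀ i, 0 < x i) → G x ≤ ⨅ i, Hm i (x i)) →
      Tendsto (fun n : ℕ => (n : ℝ) * ∫ ω, (G (V ω)) ^ (n - 1) ∂P) atTop (𝓝 κ) →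
      κ ≤ 1) := by
  obtain ⟨τ, hτ, hτG⟩ := hGdf
  obtain rfl : df τ = G := funext hτG
  have hW : Measurable fun ω => df τ (V ω) := (measurable_df τ).comp hVmeas
  have h01 : ∀ ω, df τ (V ω) ∈ Set.Icc (0 : ℝ) 1 := fun ω => df_mem_Icc τ _
  refine ⟨⟨tendsto_tail_of_tendsto_moment hW h01 hκ, tendsto_moment_of_tendsto_tail hW h01 hκ⟩,
    fun hle h => ?_⟩
  have htail := tendsto_tail_of_tendsto_moment hW h01 hκ h
  refine le_of_tendsto htail ?_
  have hone : Tendsto (fun n : ℕ => 1 - 1 / (n : ℝ)) atTop (𝓝 1) := by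
    simpa using tendsto_one_div_atTop_nhds_zero_nat.const_sub (1 : ℝ)
  let i : Fin d := ⟨0, hd⟩
  filter_upwards [hone.eventually_const_lt (hHmlt i 1), eventually_ge_atTop 1] with n hn hn1
  have hn0 : (0 : ℝ) < n := by exact_mod_cast hn1
  have hsub : {ω | 1 - 1 / (n : ℝ) < df τ (V ω)} ⊆ {ω | 1 - 1 / (n : ℝ) < Hm i (V ω i)} := by
    intro ω hω
    have h1 : df τ (V ω) ≤ Hm i (max (V ω i) 1) :=
      (df_mono_s16 τ (show V ω ≤ fun j => max (V ω j) 1 from fun j => le_max_left _ _)).trans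
        ((hle _ fun j => lt_max_of_lt_right one_pos).trans
          (ciInf_le (Set.finite_range _).bddBelow i))
    have h2 : 1 - 1 / (n : ℝ) < Hm i (max (V ω i) 1) := lt_of_lt_of_le hω h1
    rcases max_choice (V ω i) 1 with hm | hm <;> rw [hm] at h2
    · exact h2
    · exact absurd h2 hn.not_gt
  have hX : Measurable fun ω => V ω i := (measurable_pi_apply i).comp hVmeas
  have hb := (measureReal_mono (μ := P) hsub).trans (real_setOf_lt_cdf_comp_le hX (hHmdef i)
    (hHmcont i) hn.le (sub_lt_self _ (by positivity)))
  calc (n : ℝ) * P.real {ω | 1 - 1 / (n : ℝ) < df τ (V ω)}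
      ≤ n * (1 - (1 - 1 / (n : ℝ))) := mul_le_mul_of_nonneg_left hb hn0.le
    _ = 1 := by field_simp; ring
end
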